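/- arXiv:2306.05719 — 2 statements merged into one kernel-verified Lean document; each statement's English description precedes it below -/
import Mathlib

section
/- Let k ≥ 1 be an integer, d = 2k+1, and α, β ∈ ℂ \ {0}. In the affine chart x = 1, the vector field X = α·y^d ∂/∂x + (β·x^k·y·z^k − β²·z^d) ∂/∂y + (x^(d-1)·y − β·x^k·z^(k+1)) ∂/∂z induces the local vector field with components p(y,z) = β·y·z^k − β²·z^(2k+1) − α·y^(2k+2) and q(y,z) = y − β·z^(k+1) − α·y^(2k+1)·z. Then: (i) the Jacobian matrix of (p,q) at the origin is the nonzero nilpotent matrix [[0,0],[1,0]] (so the foliation has a nilpotent singularity at (1:0:0)); and (ii) the Milnor number at the origin equals d² + d + 1, i.e., dim_ℂ ℂ[[y,z]]/(p, q) = 4k² + 6k + 3. -/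
open MvPolynomial

theorem pq_identity {R : Type*} [CommRing R] (k : ℕ) (a b y z : R) :
    b * y * z ^ k - b ^ 2 * z ^ (2 * k + 1) - a * y ^ (2 * k + 2) =
      (b * z ^ k - a * y ^ (2 * k + 1)) * (y - b * z ^ (k + 1) - a * y ^ (2 * k + 1) * z)
        - a ^ 2 * (y ^ (4 * k + 2) * z) := by
  ring

theorem z_pow_mem {R : Type*} [CommRing R] (k : ℕ) {a b a' b' y z : R} (ha : a' * a = 1) (hb : b' * b = 1)
    {I : Ideal R} (hp : b * y * z ^ k - b ^ 2 * z ^ (2 * k + 1) - a * y ^ (2 * k + 2) ∈ I)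
    (hq : y - b * z ^ (k + 1) - a * y ^ (2 * k + 1) * z ∈ I) :
    z ^ (4 * k ^ 2 + 6 * k + 3) ∈ I := by
  have h1 : y ^ (4 * k + 2) * z ∈ I := by
    have h := I.sub_mem (I.mul_mem_left (b * z ^ k - a * y ^ (2 * k + 1)) hq) hp
    have h2 := I.mul_mem_left (a' ^ 2) h
    convert h2 using 1
    rw [pq_identity]
    linear_combination (-(y ^ (4 * k + 2) * z) * (a' * a + 1)) * ha
  have h3 : (b * z ^ (k + 1)) ^ (4 * k + 2) - (y * (1 - a * y ^ (2 * k) * z)) ^ (4 * k + 2) ∈ I := by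
    refine I.mem_of_dvd (sub_dvd_pow_sub_pow _ _ _) ?_
    convert I.neg_mem hq using 1
    ring
  have h4 : (b * z ^ (k + 1)) ^ (4 * k + 2) * z ∈ I := by
    have := I.add_mem (I.mul_mem_right z h3) (I.mul_mem_left ((1 - a * y ^ (2 * k) * z) ^ (4 * k + 2)) h1)
    convert this using 1
    rw [mul_pow y]
    ring
  have h5 := I.mul_mem_left (b' ^ (4 * k + 2)) h4
  convert h5 using 1
  rw [mul_pow b, ← mul_assoc, ← mul_assoc, ← mul_pow, hb, one_pow, ← pow_mul]
  ring

theorem exists_truncated_solution {R : Type*} [CommRing R] (k : ℕ) (a b t : R) (n : ℕ) :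
    ∃ y : R, t ^ (k + 1) ∣ y ∧ t ^ n ∣ y - b * t ^ (k + 1) - a * y ^ (2 * k + 1) * t := by
  induction n with
  | zero => exact ⟨0, by simp, by simp⟩
  | succ n ih =>
    obtain ⟨y, hy, hn⟩ := ih
    refine ⟨b * t ^ (k + 1) + a * y ^ (2 * k + 1) * t, ?_, ?_⟩
    · refine dvd_add (dvd_mul_left _ _) (dvd_mul_of_dvd_left (dvd_mul_of_dvd_right ?_ _) _)
      exact hy.trans (dvd_pow_self _ (by omega))
    · have h : t ^ n ∣ y - (b * t ^ (k + 1) + a * y ^ (2 * k + 1) * t) := by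
        rwa [← sub_sub]
      obtain ⟨c, hc⟩ := h.trans (sub_dvd_pow_sub_pow _ _ (2 * k + 1))
      exact ⟨a * c, by rw [pow_succ t]; linear_combination a * t * hc⟩

theorem t_pow_dvd {R : Type*} [CommRing R] (k : ℕ) {a b y t : R} (hy : t ^ (k + 1) ∣ y)
    (hq : t ^ (4 * k ^ 2 + 6 * k + 3) ∣ y - b * t ^ (k + 1) - a * y ^ (2 * k + 1) * t) :
    t ^ (4 * k ^ 2 + 6 * k + 3) ∣ b * y * t ^ k - b ^ 2 * t ^ (2 * k + 1) - a * y ^ (2 * k + 2) := by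
  rw [pq_identity]
  refine dvd_sub (dvd_mul_of_dvd_right hq _) (dvd_mul_of_dvd_right ?_ _)
  obtain ⟨c, rfl⟩ := hy
  exact ⟨c ^ (4 * k + 2), by rw [mul_pow, ← pow_mul]; ring⟩

theorem exists_eq_C_add {K : Type*} [CommRing K] (f : MvPowerSeries (Fin 2) K) :
    ∃ (c : K) (g h : MvPowerSeries (Fin 2) K),
      f = MvPowerSeries.C c + MvPowerSeries.X 0 * g + MvPowerSeries.X 1 * h := by
  let f₀ : MvPowerSeries (Fin 2) K := fun n => if n 0 = 0 then f n else 0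
  have hf₀ (m : Fin 2 →₀ ℕ) : MvPowerSeries.coeff m f₀ =
      if m 0 = 0 then MvPowerSeries.coeff m f else 0 := rfl
  have h0 : MvPowerSeries.X 0 ∣ f - f₀ := by
    rw [MvPowerSeries.X_dvd_iff]
    intro m hm
    rw [map_sub, hf₀, if_pos hm, sub_self]
  have h1 : MvPowerSeries.X 1 ∣ f₀ - MvPowerSeries.C (MvPowerSeries.coeff 0 f) := by
    rw [MvPowerSeries.X_dvd_iff]
    intro m hm
    rw [map_sub, MvPowerSeries.coeff_C, hf₀]
    by_cases h : m 0 = 0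
    · have : m = 0 := by ext i; fin_cases i <;> simp [h, hm]
      simp [this]
    · have : m ≠ 0 := by rintro rfl; simp at h
      simp [h, this]
  obtain ⟨g, hg⟩ := h0
  obtain ⟨h, hh⟩ := h1
  exact ⟨_, g, h, by linear_combination hg + hh⟩

theorem exists_sub_sum_X_pow_mem {K : Type*} [CommRing K] {I : Ideal (MvPowerSeries (Fin 2) K)}
    {r : MvPowerSeries (Fin 2) K} (hr : MvPowerSeries.X 0 - MvPowerSeries.X 1 * r ∈ I) (n : ℕ)
    (f : MvPowerSeries (Fin 2) K) :
    ∃ (c : Fin n → K) (g : MvPowerSeries (Fin 2) K),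
      f - ∑ i, c i • MvPowerSeries.X 1 ^ (i : ℕ) - MvPowerSeries.X 1 ^ n * g ∈ I := by
  induction n generalizing f with
  | zero => exact ⟨0, f, by simp⟩
  | succ n ih =>
    obtain ⟨c₀, g₀, h₀, hf⟩ := exists_eq_C_add f
    obtain ⟨c, g, hg⟩ := ih (r * g₀ + h₀)
    refine ⟨Fin.cons c₀ c, g, ?_⟩
    convert I.add_mem (I.mul_mem_left (MvPowerSeries.X 1) hg) (I.mul_mem_left g₀ hr) using 1
    rw [Fin.sum_univ_succ, hf]
    simp only [Fin.cons_zero, Fin.cons_succ, Fin.val_zero, Fin.val_succ, pow_succ', pow_zero,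
      ← mul_smul_comm, ← Finset.mul_sum, Algebra.smul_def c₀]
    simp only [MvPowerSeries.algebraMap_apply, Algebra.algebraMap_self, RingHom.id_apply]
    ring

/-- If modulo `I` the first variable is a multiple of the second one, and the `N`-th power of the
second one vanishes, and `I` vanishes to order `N` along a parametrized curve `(y(t), t)`, then the
quotient by `I` has dimension `N`. -/
theorem finrank_quotient_eq {K : Type*} [Field K] {I : Ideal (MvPowerSeries (Fin 2) K)} {N : ℕ}
    {r : MvPowerSeries (Fin 2) K} (hr : MvPowerSeries.X 0 - MvPowerSeries.X 1 * r ∈ I)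
    (hN : MvPowerSeries.X 1 ^ N ∈ I) (φ : MvPowerSeries (Fin 2) K →ₐ[K] PowerSeries K)
    (hφ : φ (MvPowerSeries.X 1) = PowerSeries.X) (hI : ∀ f ∈ I, PowerSeries.X ^ N ∣ φ f) :
    Module.finrank K (MvPowerSeries (Fin 2) K ⧸ I) = N := by
  let e : (Fin N → K) →ₗ[K] MvPowerSeries (Fin 2) K ⧸ I :=
    Fintype.linearCombination K fun i => Ideal.Quotient.mkₐ K I (MvPowerSeries.X 1 ^ (i : ℕ))
  have he : Function.Surjective e := by
    intro x
    obtain ⟨f, rfl⟩ := Ideal.Quotient.mkₐ_surjective K I x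
    obtain ⟨c, g, h⟩ := exists_sub_sum_X_pow_mem hr N f
    refine ⟨c, ?_⟩
    have h' : f - ∑ i, c i • MvPowerSeries.X 1 ^ (i : ℕ) ∈ I := by
      simpa using I.add_mem h (I.mul_mem_right g hN)
    rw [← Ideal.Quotient.eq_zero_iff_mem, ← Ideal.Quotient.mkₐ_eq_mk K, map_sub, sub_eq_zero] at h'
    rw [h', map_sum]
    simp only [e, Fintype.linearCombination_apply, map_smul]
  let π : MvPowerSeries (Fin 2) K →ₗ[K] (Fin N → K) :=
    LinearMap.pi fun i => PowerSeries.coeff (i : ℕ) ∘ₗ φ.toLinearMap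
  have hπ : I.restrictScalars K ≤ LinearMap.ker π := by
    intro f hf
    rw [LinearMap.mem_ker]
    ext i
    exact PowerSeries.X_pow_dvd_iff.1 (hI f hf) i i.2
  let ψ : (MvPowerSeries (Fin 2) K ⧸ I) →ₗ[K] (Fin N → K) :=
    (I.restrictScalars K).liftQ π hπ
  have hψe : ∀ c, ψ (e c) = c := by
    intro c
    have : e c = Ideal.Quotient.mk I (∑ i, c i • MvPowerSeries.X 1 ^ (i : ℕ)) := by
      rw [← Ideal.Quotient.mkₐ_eq_mk K, map_sum]
      simp only [e, Fintype.linearCombination_apply, map_smul]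
    rw [this]
    change π _ = c
    ext j
    simp [π, hφ, PowerSeries.coeff_X_pow, ← Fin.ext_iff]
  have : Module.finrank K (Fin N → K) = N := by simp
  rw [← (LinearEquiv.ofBijective e ⟨Function.LeftInverse.injective hψe, he⟩).finrank_eq, this]


open MvPolynomial

/-- For `d = 2k+1`, `α, β ≠ 0`, the local vector field in the chart `x = 1` with components
`p = β y z^k − β² z^(2k+1) − α y^(2k+2)` and `q = y − β z^(k+1) − α y^(2k+1) z`
has (i) Jacobian matrix at the origin equal to the nonzero nilpotent matrix `[[0,0],[1,0]]`,
and (ii) Milnor number `d² + d + 1`, i.e. `dim_ℂ ℂ[[y,z]]/(p,q) = 4k² + 6k + 3`. -/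
theorem stmt_5 (k d : ℕ) (hk : 1 ≤ k) (hd : d = 2 * k + 1)
    (α β : ℂ) (hα : α ≠ 0) (hβ : β ≠ 0)
    (p q : MvPolynomial (Fin 2) ℂ)
    (hp : p = C β * X 0 * X 1 ^ k - C (β ^ 2) * X 1 ^ (2 * k + 1) - C α * X 0 ^ (2 * k + 2))
    (hq : q = X 0 - C β * X 1 ^ (k + 1) - C α * X 0 ^ (2 * k + 1) * X 1)
    (J : Matrix (Fin 2) (Fin 2) ℂ)
    (hJ : J = !![eval (0 : Fin 2 → ℂ) (pderiv 0 p), eval (0 : Fin 2 → ℂ) (pderiv 1 p);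
                 eval (0 : Fin 2 → ℂ) (pderiv 0 q), eval (0 : Fin 2 → ℂ) (pderiv 1 q)]) :
    (J = !![0, 0; 1, 0] ∧ J ≠ 0 ∧ IsNilpotent J) ∧
    Module.finrank ℂ
      (MvPowerSeries (Fin 2) ℂ ⧸
        Ideal.span {(p : MvPowerSeries (Fin 2) ℂ), (q : MvPowerSeries (Fin 2) ℂ)}) =
      4 * k ^ 2 + 6 * k + 3 := by
  refine ⟨?_, ?_⟩
  · have hJ' : J = !![0, 0; 1, 0] := by
      have hk0 : k ≠ 0 := by omega
      subst hJ hp hq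
      simp [hk0]
    refine ⟨hJ', ?_, 2, ?_⟩
    · rw [hJ']
      intro h
      simpa using congr_fun₂ h 1 0
    · rw [hJ', sq]
      ext i j
      fin_cases i <;> fin_cases j <;> simp
  · have hp' : (p : MvPowerSeries (Fin 2) ℂ) = MvPowerSeries.C β * MvPowerSeries.X 0 *
        MvPowerSeries.X 1 ^ k - MvPowerSeries.C β ^ 2 * MvPowerSeries.X 1 ^ (2 * k + 1) -
        MvPowerSeries.C α * MvPowerSeries.X 0 ^ (2 * k + 2) := by
      rw [hp, ← MvPolynomial.coeToMvPowerSeries.ringHom_apply]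
      simp only [map_sub, map_mul, map_pow, MvPolynomial.coeToMvPowerSeries.ringHom_apply,
        MvPolynomial.coe_C, MvPolynomial.coe_X]
    have hq' : (q : MvPowerSeries (Fin 2) ℂ) = MvPowerSeries.X 0 - MvPowerSeries.C β *
        MvPowerSeries.X 1 ^ (k + 1) - MvPowerSeries.C α * MvPowerSeries.X 0 ^ (2 * k + 1) *
        MvPowerSeries.X 1 := by
      rw [hq, ← MvPolynomial.coeToMvPowerSeries.ringHom_apply]
      simp only [map_sub, map_mul, map_pow, MvPolynomial.coeToMvPowerSeries.ringHom_apply,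
        MvPolynomial.coe_C, MvPolynomial.coe_X]
    have hC {c : ℂ} (hc : c ≠ 0) : (MvPowerSeries.C c⁻¹ : MvPowerSeries (Fin 2) ℂ) *
        MvPowerSeries.C c = 1 := by
      rw [← map_mul, inv_mul_cancel₀ hc, map_one]
    set I := Ideal.span {(p : MvPowerSeries (Fin 2) ℂ), (q : MvPowerSeries (Fin 2) ℂ)} with hI
    have hpI : (p : MvPowerSeries (Fin 2) ℂ) ∈ I := Ideal.subset_span (by simp)
    have hqI : (q : MvPowerSeries (Fin 2) ℂ) ∈ I := Ideal.subset_span (by simp)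
    obtain ⟨y, hy, hyq⟩ := exists_truncated_solution k (PowerSeries.C α) (PowerSeries.C β)
      (PowerSeries.X : PowerSeries ℂ) (4 * k ^ 2 + 6 * k + 3)
    have hy0 : PowerSeries.constantCoeff y = 0 :=
      PowerSeries.X_dvd_iff.1 ((dvd_pow_self _ k.succ_ne_zero).trans hy)
    have hs : MvPowerSeries.HasSubst (![y, PowerSeries.X] : Fin 2 → MvPowerSeries Unit ℂ) := by
      refine MvPowerSeries.hasSubst_of_constantCoeff_zero fun s => ?_
      fin_cases s
      · exact hy0
      · exact PowerSeries.constantCoeff_X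
    let φ : MvPowerSeries (Fin 2) ℂ →ₐ[ℂ] PowerSeries ℂ := MvPowerSeries.substAlgHom hs
    have hφ0 : φ (MvPowerSeries.X 0) = y := MvPowerSeries.substAlgHom_X hs 0
    have hφ1 : φ (MvPowerSeries.X 1) = PowerSeries.X := MvPowerSeries.substAlgHom_X hs 1
    have hφC (c : ℂ) : φ (MvPowerSeries.C c) = PowerSeries.C c := φ.commutes c
    refine finrank_quotient_eq (r := MvPowerSeries.C β * MvPowerSeries.X 1 ^ k +
      MvPowerSeries.C α * MvPowerSeries.X 0 ^ (2 * k + 1)) ?_ ?_ φ hφ1 ?_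
    · convert hqI using 1
      rw [hq']
      ring
    · exact z_pow_mem k (hC hα) (hC hβ) (hp' ▸ hpI) (hq' ▸ hqI)
    · have hle : I ≤ (Ideal.span {PowerSeries.X ^ (4 * k ^ 2 + 6 * k + 3)}).comap φ := by
        rw [hI, Ideal.span_le]
        rintro f (rfl | rfl)
        · simp only [SetLike.mem_coe, Ideal.mem_comap, Ideal.mem_span_singleton, hp', map_sub,
            map_mul, map_pow, hφ0, hφ1, hφC]
          exact t_pow_dvd k hy hyq
        · simpa only [SetLike.mem_coe, Ideal.mem_comap, Ideal.mem_span_singleton, hq', map_sub,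
            map_mul, map_pow, hφ0, hφ1, hφC] using hyq
      exact fun f hf => Ideal.mem_span_singleton.1 (hle hf)
end

section
/- Let A, B ∈ ℂ[x,y,z] be the dx- and dy-coefficients of the 1-form ω̃, namely A = −x⁷y − x⁷z + 4x⁶y² + 4x⁶yz + 2x⁶z² − 5x⁵y³ − 4x⁵y²z + x⁵yz² + x⁴y⁴ − 4x⁴y³z − 3x⁴y²z² − 3x⁴yz³ − x⁴z⁴ + 4x³y⁵ + 9x³y⁴z + 12x³y³z² + 5x³y²z³ − 6x²y⁶ − 15x²y⁵z − 9x²y⁴z² + 6xy⁷ + 7xy⁶z − 2y⁸ and B = x⁸ − 4x⁷y − 2x⁷z + 5x⁶y² + 3x⁶yz − x⁵y³ + 2x⁵y²z − 4x⁴y⁴ − 6x⁴y³z − 6x⁴y²z² − 2x⁴yz³ + 6x³y⁵ + 12x³y⁴z + 6x³y³z² − 6x²y⁶ − 6x²y⁵z + 2xy⁷. In the affine chart z = 1, set a(x,y) = A(x,y,1) and b(x,y) = B(x,y,1). Then the singularity of the foliation at the origin (i.e., at (0:0:1)) has multiplicity 4, that is min(ord(a), ord(b)) = 4, and Milnor number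 57, that is dim_ℂ ℂ[[x,y]]/(a, b) = 57. -/
open MvPolynomial

/-- The order (smallest total degree of a monomial with nonzero coefficient)
of a polynomial in two variables. -/
noncomputable def polyOrd (p : MvPolynomial (Fin 2) ℂ) : ℕ :=
  sInf {k | ∃ d ∈ p.support, (∑ i, d i) = k}

section LocalIntersection

variable {R : Type*} [CommRing R]

theorem dvd_of_dvd_pow_mul {f g : R} (hg : ∀ t, f ∣ g * t → f ∣ t) (k : ℕ) :
    ∀ t, f ∣ g ^ k * t → f ∣ t := by
  induction k with
  | zero => simp
  | succ k ih =>
    intro t ht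
    rw [pow_succ, mul_assoc] at ht
    exact hg t (ih _ ht)

/-- If `g ≡ p` modulo `q`, where `p` is a nonzerodivisor modulo `q`, then `q` is a nonzerodivisor
modulo `g`. -/
theorem dvd_of_dvd_mul_of_eq_mul_add [IsDomain R] {g q p w : R} (hq : q ≠ 0)
    (hp : ∀ t, q ∣ p * t → q ∣ t) (hgq : g = q * w + p) (t : R) (ht : g ∣ q * t) : g ∣ t := by
  obtain ⟨s, hs⟩ := ht
  obtain ⟨r, rfl⟩ := hp s ⟨t - w * s, by rw [hgq] at hs; linear_combination -hs⟩
  refine ⟨r, mul_left_cancel₀ hq ?_⟩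
  linear_combination hs

variable [Algebra ℂ R]

/-- The (cardinal) local intersection number of `f` and `g`. -/
noncomputable def interRank (f g : R) : Cardinal :=
  Module.rank ℂ (R ⧸ Ideal.span {f, g})

theorem interRank_comm (f g : R) : interRank f g = interRank g f := by
  rw [interRank, interRank, Set.pair_comm]

theorem interRank_eq_of_span_eq {f g f' g' : R}
    (h : Ideal.span {f, g} = Ideal.span {f', g'}) : interRank f g = interRank f' g' := by
  rw [interRank, interRank, h]

theorem interRank_add_mul_left (f g c : R) : interRank f (g + c * f) = interRank f g := by
  apply interRank_eq_of_span_eq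
  rw [Ideal.span_pair_comm, Ideal.span_pair_add_mul_right, Ideal.span_pair_comm]

theorem interRank_one (f : R) : interRank f 1 = 0 := by
  have h : Ideal.span {f, (1 : R)} = ⊤ :=
    (Ideal.eq_top_iff_one _).2 (Ideal.subset_span (by simp))
  rw [interRank, h]
  exact rank_subsingleton' _ _

/-- Additivity of the intersection number when `g` is a nonzerodivisor modulo `f`. -/
theorem interRank_mul {f g : R} (hg : ∀ t, f ∣ g * t → f ∣ t) (h : R) :
    interRank f (g * h) = interRank f g + interRank f h := by
  have hle : Ideal.span {f, g * h} ≤ Ideal.span {f, g} := by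
    rw [Ideal.span_le]
    rintro _ (rfl | rfl)
    · exact Ideal.subset_span (by simp)
    · exact Ideal.mul_mem_right _ _ (Ideal.subset_span (by simp))
  let π : (R ⧸ Ideal.span {f, g * h}) →ₗ[ℂ] (R ⧸ Ideal.span {f, g}) :=
    (Ideal.Quotient.factorₐ ℂ hle).toLinearMap
  have hπ : Function.Surjective π := Ideal.Quotient.factor_surjective hle
  let μ : R →ₗ[ℂ] (R ⧸ Ideal.span {f, g * h}) :=
    (Ideal.Quotient.mkₐ ℂ (Ideal.span {f, g * h})).toLinearMap ∘ₗ LinearMap.mulLeft ℂ g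
  have hμ : ∀ t, μ t = Ideal.Quotient.mk _ (g * t) := fun t => rfl
  have hkerμ : LinearMap.ker μ = (Ideal.span {f, h}).restrictScalars ℂ := by
    ext t
    rw [LinearMap.mem_ker, hμ, Ideal.Quotient.eq_zero_iff_mem, Submodule.restrictScalars_mem,
      Ideal.mem_span_pair, Ideal.mem_span_pair]
    constructor
    · rintro ⟨a, b, hab⟩
      obtain ⟨c, hc⟩ := hg (t - b * h) ⟨a, by linear_combination -hab⟩
      exact ⟨c, b, by linear_combination -hc⟩
    · rintro ⟨a, b, rfl⟩
      exact ⟨g * a, b, by ring⟩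
  have hrange : LinearMap.range μ = LinearMap.ker π := by
    ext u
    obtain ⟨u, rfl⟩ := Ideal.Quotient.mk_surjective u
    have h1 : π (Ideal.Quotient.mk _ u) = Ideal.Quotient.mk _ u := rfl
    rw [LinearMap.mem_ker, h1, Ideal.Quotient.eq_zero_iff_mem, LinearMap.mem_range,
      Ideal.mem_span_pair]
    constructor
    · rintro ⟨t, ht⟩
      rw [hμ, Ideal.Quotient.eq, Ideal.mem_span_pair] at ht
      obtain ⟨a, b, hab⟩ := ht
      exact ⟨-a, t - b * h, by linear_combination -hab⟩
    · rintro ⟨a, b, rfl⟩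
      refine ⟨b, ?_⟩
      rw [hμ, Ideal.Quotient.eq, Ideal.mem_span_pair]
      exact ⟨-a, 0, by ring⟩
  have e : Module.rank ℂ (LinearMap.range μ) = interRank f h := by
    rw [← μ.quotKerEquivRange.rank_eq, hkerμ]
    exact (Submodule.Quotient.restrictScalarsEquiv ℂ (Ideal.span {f, h})).rank_eq
  rw [← e, hrange]
  exact LinearMap.rank_eq_of_surjective hπ

theorem interRank_pow_mul {f g : R} (hg : ∀ t, f ∣ g * t → f ∣ t) (k : ℕ) (h : R) :
    interRank f (g ^ k * h) = k * interRank f g + interRank f h := by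
  induction k with
  | zero => simp
  | succ k ih =>
    rw [pow_succ', mul_assoc, interRank_mul hg, ih]
    push_cast
    ring

end LocalIntersection

namespace MvPowerSeries

theorem X_dvd_of_X_dvd_X_mul {s : MvPowerSeries (Fin 2) ℂ}
    (h : (X 0 : MvPowerSeries (Fin 2) ℂ) ∣ X 1 * s) : (X 0 : MvPowerSeries (Fin 2) ℂ) ∣ s := by
  rw [X_dvd_iff] at h ⊢
  intro m hm
  have h1 := h (Finsupp.single 1 1 + m) (by simp [hm])
  rw [X, coeff_add_monomial_mul, one_mul] at h1
  exact h1

theorem mem_span_X_of_constantCoeff_eq_zero {f : MvPowerSeries (Fin 2) ℂ}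
    (hf : constantCoeff f = 0) :
    f ∈ Ideal.span {(X 0 : MvPowerSeries (Fin 2) ℂ), X 1} := by
  let f₁ : MvPowerSeries (Fin 2) ℂ := fun m => if m 0 = 0 then coeff m f else 0
  have hc : ∀ m, coeff m f₁ = if m 0 = 0 then coeff m f else 0 := fun m => rfl
  have h0 : (X 0 : MvPowerSeries (Fin 2) ℂ) ∣ f - f₁ := by
    rw [X_dvd_iff]
    intro m hm
    rw [map_sub, hc, if_pos hm, sub_self]
  have h1 : (X 1 : MvPowerSeries (Fin 2) ℂ) ∣ f₁ := by
    rw [X_dvd_iff]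
    intro m hm
    rw [hc]
    split_ifs with hm0
    · have : m = 0 := by
        ext i
        fin_cases i
        · exact hm0
        · exact hm
      rw [this, coeff_zero_eq_constantCoeff_apply, hf]
    · rfl
  obtain ⟨a, ha⟩ := h0
  obtain ⟨b, hb⟩ := h1
  rw [Ideal.mem_span_pair]
  exact ⟨a, b, by linear_combination -ha - hb⟩

theorem interRank_X_X : interRank (X 0 : MvPowerSeries (Fin 2) ℂ) (X 1) = 1 := by
  let φ : MvPowerSeries (Fin 2) ℂ →ₗ[ℂ] ℂ := coeff 0
  have hφ : ∀ f, φ f = constantCoeff f := fun f => coeff_zero_eq_constantCoeff_apply f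
  have hker : LinearMap.ker φ =
      (Ideal.span {(X 0 : MvPowerSeries (Fin 2) ℂ), X 1}).restrictScalars ℂ := by
    ext f
    rw [LinearMap.mem_ker, hφ, Submodule.restrictScalars_mem]
    refine ⟨mem_span_X_of_constantCoeff_eq_zero, fun h => ?_⟩
    obtain ⟨a, b, rfl⟩ := Ideal.mem_span_pair.1 h
    simp
  have hs : Function.Surjective φ := fun c => ⟨C c, by rw [hφ, constantCoeff_C]⟩
  have e := (φ.quotKerEquivOfSurjective hs).rank_eq
  rw [hker, Module.rank_self] at e
  rw [← e]
  exact (Submodule.Quotient.restrictScalarsEquiv ℂ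
    (Ideal.span {(X 0 : MvPowerSeries (Fin 2) ℂ), X 1})).rank_eq.symm

theorem not_X_dvd_one : ¬ (X 0 : MvPowerSeries (Fin 2) ℂ) ∣ 1 := by
  intro h
  have := map_dvd (constantCoeff (σ := Fin 2) (R := ℂ)) h
  simp at this

variable {f u r : MvPowerSeries (Fin 2) ℂ} {n : ℕ}

theorem dvd_of_dvd_X_mul (hu : IsUnit u) (hf : f = u * X 1 ^ n + X 0 * r)
    (t : MvPowerSeries (Fin 2) ℂ) (ht : f ∣ X 0 * t) : f ∣ t := by
  obtain ⟨s, hs⟩ := ht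
  obtain ⟨v, hv⟩ := hu.exists_left_inv
  have h1 : (X 0 : MvPowerSeries (Fin 2) ℂ) ∣ X 1 ^ n * s :=
    ⟨v * (t - r * s), by rw [hf] at hs; linear_combination -v * hs - X 1 ^ n * s * hv⟩
  obtain ⟨c, rfl⟩ := dvd_of_dvd_pow_mul (fun _ => X_dvd_of_X_dvd_X_mul) n s h1
  have h0 : (X 0 : MvPowerSeries (Fin 2) ℂ) ≠ 0 := by
    intro h
    have := congrArg (coeff (Finsupp.single 0 1)) h
    simp at this
  refine ⟨c, mul_left_cancel₀ h0 ?_⟩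
  linear_combination hs

theorem interRank_X (hu : IsUnit u) (hf : f = u * X 1 ^ n + X 0 * r) :
    interRank f (X 0) = n := by
  have h1 : interRank f (X 0) = interRank (X 0) ((X 1 : MvPowerSeries (Fin 2) ℂ) ^ n * 1) := by
    rw [interRank_comm]
    apply interRank_eq_of_span_eq
    obtain ⟨v, hv⟩ := hu.exists_left_inv
    apply le_antisymm <;> rw [Ideal.span_le] <;> rintro _ (rfl | rfl)
    · exact Ideal.subset_span (by simp)
    · exact Ideal.mem_span_pair.2 ⟨r, u, by rw [hf]; ring⟩
    · exact Ideal.subset_span (by simp)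
    · exact Ideal.mem_span_pair.2 ⟨-v * r, v, by rw [hf]; linear_combination X 1 ^ n * hv⟩
  rw [h1, interRank_pow_mul (fun _ => X_dvd_of_X_dvd_X_mul), interRank_one, interRank_X_X]
  simp

theorem interRank_X_pow_mul (hu : IsUnit u) (hf : f = u * X 1 ^ n + X 0 * r) (k : ℕ)
    (h : MvPowerSeries (Fin 2) ℂ) :
    interRank f (X 0 ^ k * h) = (k * n : ℕ) + interRank f h := by
  rw [interRank_pow_mul (dvd_of_dvd_X_mul hu hf), interRank_X hu hf]
  push_cast
  rfl

theorem ne_zero_of_eq_mul_add (hu : IsUnit u) (hf : f = u * X 1 ^ n + X 0 * r) : f ≠ 0 := by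
  rintro rfl
  obtain ⟨v, hv⟩ := hu.exists_left_inv
  refine not_X_dvd_one (dvd_of_dvd_pow_mul (fun _ => X_dvd_of_X_dvd_X_mul) n 1 ⟨-v * r, ?_⟩)
  linear_combination -v * hf - X 1 ^ n * hv

theorem isUnit_two : IsUnit (2 : MvPowerSeries (Fin 2) ℂ) := by
  rw [isUnit_iff_constantCoeff, map_ofNat]
  exact isUnit_iff_ne_zero.2 two_ne_zero

end MvPowerSeries

namespace MvPolynomial

theorem le_polyOrd {p : MvPolynomial (Fin 2) ℂ} {k : ℕ} (hp : p ≠ 0)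
    (h : p ∈ idealOfVars (Fin 2) ℂ ^ k) : k ≤ polyOrd p := by
  rw [mem_pow_idealOfVars_iff] at h
  obtain ⟨d, hd⟩ := Finset.nonempty_iff_ne_empty.2 (mt support_eq_empty.1 hp)
  refine le_csInf ⟨_, d, hd, rfl⟩ ?_
  rintro _ ⟨d, hd, rfl⟩
  have := h d hd
  rwa [Finsupp.degree_eq_sum] at this

theorem X_pow_mul_X_pow_mem (i j : ℕ) (c : MvPolynomial (Fin 2) ℂ) :
    X 0 ^ i * X 1 ^ j * c ∈ idealOfVars (Fin 2) ℂ ^ (i + j) := by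
  rw [pow_add]
  exact Ideal.mul_mem_right _ _ (Ideal.mul_mem_mul
    (Ideal.pow_mem_pow (Ideal.subset_span (Set.mem_range_self 0)) _)
    (Ideal.pow_mem_pow (Ideal.subset_span (Set.mem_range_self 1)) _))

/-- A combination of the monomials of degree five lies in the fifth power of the maximal ideal. -/
theorem mem_pow_five (c₀ c₁ c₂ c₃ c₄ c₅ : MvPolynomial (Fin 2) ℂ) :
    X 0 ^ 5 * X 1 ^ 0 * c₀ + X 0 ^ 4 * X 1 ^ 1 * c₁ + X 0 ^ 3 * X 1 ^ 2 * c₂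
      + X 0 ^ 2 * X 1 ^ 3 * c₃ + X 0 ^ 1 * X 1 ^ 4 * c₄ + X 0 ^ 0 * X 1 ^ 5 * c₅
      ∈ idealOfVars (Fin 2) ℂ ^ 5 :=
  add_mem (add_mem (add_mem (add_mem (add_mem (X_pow_mul_X_pow_mem 5 0 c₀)
    (X_pow_mul_X_pow_mem 4 1 c₁)) (X_pow_mul_X_pow_mem 3 2 c₂)) (X_pow_mul_X_pow_mem 2 3 c₃))
    (X_pow_mul_X_pow_mem 1 4 c₄)) (X_pow_mul_X_pow_mem 0 5 c₅)

/-- If `p ≡ -x ^ 4` up to terms of order at least five, then `p` has order four. -/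
theorem polyOrd_eq_four {p : MvPolynomial (Fin 2) ℂ}
    (h : p + X 0 ^ 4 ∈ idealOfVars (Fin 2) ℂ ^ 5) : polyOrd p = 4 := by
  have hc : coeff (Finsupp.single 0 4) p = -1 := by
    have := (mem_pow_idealOfVars_iff' 5 _).1 h (Finsupp.single 0 4) (by simp)
    rw [coeff_add, coeff_X_pow, if_pos rfl] at this
    exact eq_neg_of_add_eq_zero_left this
  have hne : coeff (Finsupp.single 0 4) p ≠ 0 := by simp [hc]
  apply le_antisymm
  · refine Nat.sInf_le ⟨Finsupp.single 0 4, mem_support_iff.2 hne, ?_⟩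
    simp
  · refine le_polyOrd (fun h0 => hne (by simp [h0])) ?_
    have h4 : (X 0 ^ 4 : MvPolynomial (Fin 2) ℂ) ∈ idealOfVars (Fin 2) ℂ ^ 4 :=
      Ideal.pow_mem_pow (Ideal.subset_span (Set.mem_range_self 0)) _
    simpa using sub_mem (Ideal.pow_le_pow_right (by norm_num) h) h4

end MvPolynomial

namespace MvPowerSeries

/-- The Milnor number, computed by successively splitting off powers of `x`. -/
theorem interRank_chain {x y a b b' e g q : MvPowerSeries (Fin 2) ℂ}
    (hx : x = X 0) (hy : y = X 1)
    (hb : b = x * b') (ha : a = x * e - y * b') (hb' : b' = 2 * y * e + x ^ 4 * g)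
    (he : e = q ^ 3 - x ^ 3 * g) (hg : g = y * q + x * (x ^ 2 + 2 * q))
    (hq : q = y ^ 2 - x - x * y) :
    interRank a b = 57 := by
  have nq : q = 1 * X 1 ^ 2 + X 0 * (-1 - y) := by
    rw [hq, ← hx, ← hy]; ring
  obtain ⟨re, ne⟩ : ∃ r, e = 1 * X 1 ^ 6 + X 0 * r := by
    refine ⟨-(1 + y) * (y ^ 4 + y ^ 2 * q + q ^ 2) - x ^ 2 * g, ?_⟩
    rw [he, ← hx, ← hy, hq]; ring
  obtain ⟨rb, nb⟩ : ∃ r, b' = 2 * X 1 ^ 7 + X 0 * r := by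
    refine ⟨2 * y * re + x ^ 3 * g, ?_⟩
    rw [hb', ne, ← hx, ← hy]; ring
  obtain ⟨ra, na⟩ : ∃ r, a = -2 * X 1 ^ 8 + X 0 * r := by
    refine ⟨e - y * rb, ?_⟩
    rw [ha, nb, ← hx, ← hy]; ring
  have u2 := isUnit_two
  have iq : interRank g q = 6 := by
    rw [interRank_comm, show g = X 0 ^ 3 * 1 + (y + 2 * x) * q by rw [hg, ← hx]; ring,
      interRank_add_mul_left, interRank_X_pow_mul isUnit_one nq, interRank_one]
    norm_num
  have ig : interRank e g = 18 := by
    have : IsDomain (MvPowerSeries (Fin 2) ℂ) := NoZeroDivisors.to_isDomain _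
    have hreg : ∀ t, g ∣ q * t → g ∣ t :=
      dvd_of_dvd_mul_of_eq_mul_add (ne_zero_of_eq_mul_add isUnit_one nq)
        (dvd_of_dvd_pow_mul (dvd_of_dvd_X_mul isUnit_one nq) 3)
        (show g = q * (y + 2 * x) + X 0 ^ 3 by rw [hg, ← hx]; ring)
    rw [interRank_comm, show e = q ^ 3 * 1 + (-x ^ 3) * g by rw [he]; ring,
      interRank_add_mul_left, interRank_pow_mul hreg, interRank_one, iq]
    norm_num
  have ie : interRank b' e = 42 := by
    rw [interRank_comm, show b' = X 0 ^ 4 * g + (2 * y) * e by rw [hb', ← hx]; ring,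
      interRank_add_mul_left, interRank_X_pow_mul isUnit_one ne, ig]
    norm_num
  have ib : interRank a b' = 49 := by
    rw [interRank_comm, show a = X 0 ^ 1 * e + (-y) * b' by rw [ha, ← hx]; ring,
      interRank_add_mul_left, interRank_X_pow_mul u2 nb, ie]
    norm_num
  rw [show b = X 0 ^ 1 * b' by rw [hb, ← hx]; ring, interRank_X_pow_mul u2.neg na, ib]
  norm_num

end MvPowerSeries

set_option maxHeartbeats 2000000 in
/-- In the chart `z = 1`, the singularity at the origin (i.e. at `(0:0:1)`) of the
degree-7 foliation `ω̃` has multiplicity `4` and Milnor number `57`. -/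
theorem stmt_10 (x y z A B : MvPolynomial (Fin 3) ℂ)
    (hx : x = X 0) (hy : y = X 1) (hz : z = X 2)
    (hA : A = -(x^7*y) - x^7*z + 4*x^6*y^2 + 4*x^6*y*z + 2*x^6*z^2 - 5*x^5*y^3
        - 4*x^5*y^2*z + x^5*y*z^2 + x^4*y^4 - 4*x^4*y^3*z - 3*x^4*y^2*z^2
        - 3*x^4*y*z^3 - x^4*z^4 + 4*x^3*y^5 + 9*x^3*y^4*z + 12*x^3*y^3*z^2
        + 5*x^3*y^2*z^3 - 6*x^2*y^6 - 15*x^2*y^5*z - 9*x^2*y^4*z^2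
        + 6*x*y^7 + 7*x*y^6*z - 2*y^8)
    (hB : B = x^8 - 4*x^7*y - 2*x^7*z + 5*x^6*y^2 + 3*x^6*y*z - x^5*y^3
        + 2*x^5*y^2*z - 4*x^4*y^4 - 6*x^4*y^3*z - 6*x^4*y^2*z^2 - 2*x^4*y*z^3
        + 6*x^3*y^5 + 12*x^3*y^4*z + 6*x^3*y^3*z^2 - 6*x^2*y^6 - 6*x^2*y^5*z
        + 2*x*y^7)
    (a b : MvPolynomial (Fin 2) ℂ)
    (ha : a = aeval ![X 0, X 1, 1] A)
    (hb : b = aeval ![X 0, X 1, 1] B) :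
    min (polyOrd a) (polyOrd b) = 4 ∧
    Module.finrank ℂ
      (MvPowerSeries (Fin 2) ℂ ⧸
        Ideal.span {(a : MvPowerSeries (Fin 2) ℂ), (b : MvPowerSeries (Fin 2) ℂ)}) = 57 := by
  have ha' : a = -(X 0^7*X 1) - X 0^7 + 4*X 0^6*X 1^2 + 4*X 0^6*X 1 + 2*X 0^6 - 5*X 0^5*X 1^3
        - 4*X 0^5*X 1^2 + X 0^5*X 1 + X 0^4*X 1^4 - 4*X 0^4*X 1^3 - 3*X 0^4*X 1^2
        - 3*X 0^4*X 1 - X 0^4 + 4*X 0^3*X 1^5 + 9*X 0^3*X 1^4 + 12*X 0^3*X 1^3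
        + 5*X 0^3*X 1^2 - 6*X 0^2*X 1^6 - 15*X 0^2*X 1^5 - 9*X 0^2*X 1^4
        + 6*X 0*X 1^7 + 7*X 0*X 1^6 - 2*X 1^8 := by
    rw [ha, hA, hx, hy, hz]
    simp [map_ofNat]
  have hb' : b = X 0^8 - 4*X 0^7*X 1 - 2*X 0^7 + 5*X 0^6*X 1^2 + 3*X 0^6*X 1 - X 0^5*X 1^3
        + 2*X 0^5*X 1^2 - 4*X 0^4*X 1^4 - 6*X 0^4*X 1^3 - 6*X 0^4*X 1^2 - 2*X 0^4*X 1
        + 6*X 0^3*X 1^5 + 12*X 0^3*X 1^4 + 6*X 0^3*X 1^3 - 6*X 0^2*X 1^6 - 6*X 0^2*X 1^5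
        + 2*X 0*X 1^7 := by
    rw [hb, hB, hx, hy, hz]
    simp [map_ofNat]
  clear ha hb hA hB hx hy hz
  constructor
  · have oa : polyOrd a = 4 := by
      apply polyOrd_eq_four
      rw [ha']
      convert mem_pow_five
        (-X 0^2*X 1 - X 0^2 + 4*X 0*X 1^2 + 4*X 0*X 1 + 2*X 0 - 5*X 1^3 - 4*X 1^2 + X 1)
        (X 1^3 - 4*X 1^2 - 3*X 1 - 3) (4*X 1^3 + 9*X 1^2 + 12*X 1 + 5)
        (-6*X 1^3 - 15*X 1^2 - 9*X 1) (6*X 1^3 + 7*X 1^2) (-2*X 1^3) using 1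
      ring
    have ob : 5 ≤ polyOrd b := by
      apply le_polyOrd
      · intro h0
        have := congrArg (eval ![(1 : ℂ), 0]) (hb'.symm.trans h0)
        norm_num at this
      · rw [hb']
        convert mem_pow_five
          (X 0^3 - 4*X 0^2*X 1 - 2*X 0^2 + 5*X 0*X 1^2 + 3*X 0*X 1 - X 1^3 + 2*X 1^2)
          (-4*X 1^3 - 6*X 1^2 - 6*X 1 - 2) (6*X 1^3 + 12*X 1^2 + 6*X 1)
          (-6*X 1^3 - 6*X 1^2) (2*X 1^3) 0 using 1
        ring
    omega
  · obtain ⟨Q, hQ⟩ : ∃ Q : MvPolynomial (Fin 2) ℂ, Q = X 1^2 - X 0 - X 0 * X 1 := ⟨_, rfl⟩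
    obtain ⟨G, hG⟩ : ∃ G, G = X 1 * Q + X 0 * (X 0^2 + 2 * Q) := ⟨_, rfl⟩
    obtain ⟨E, hE⟩ : ∃ E, E = Q^3 - X 0^3 * G := ⟨_, rfl⟩
    obtain ⟨B', hB'⟩ : ∃ B', B' = 2 * X 1 * E + X 0^4 * G := ⟨_, rfl⟩
    have hbB : b = X 0 * B' := by rw [hb', hB', hE, hG, hQ]; ring
    have haE : a = X 0 * E - X 1 * B' := by rw [ha', hB', hE, hG, hQ]; ring
    let φ := coeToMvPowerSeries.ringHom (σ := Fin 2) (R := ℂ)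
    have key : interRank (φ a) (φ b) = 57 :=
      MvPowerSeries.interRank_chain (x := φ (X 0)) (y := φ (X 1)) (b' := φ B') (e := φ E) (g := φ G) (q := φ Q)
        (coe_X 0) (coe_X 1) (by simp only [hbB, map_mul]) (by simp only [haE, map_mul, map_sub])
        (by simp only [hB', map_mul, map_add, map_pow, map_ofNat])
        (by simp only [hE, map_mul, map_sub, map_pow])
        (by simp only [hG, map_mul, map_add, map_pow, map_ofNat])
        (by simp only [hQ, map_mul, map_sub, map_pow])
    exact Module.finrank_eq_of_rank_eq key
end
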